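/- arXiv:2003.03467 — 3 statements merged into one kernel-verified Lean document; each statement's English description precedes it below -/
import Mathlib

section
/- Let a110, a101, a011, a100, a010, a001, a000 and their primed counterparts and g be smooth real functions on ℝ³, and define L u = ∂_x∂_y∂_z u + a110·∂_x∂_y u + a101·∂_x∂_z u + a011·∂_y∂_z u + a100·∂_x u + a010·∂_y u + a001·∂_z u + a000·u, and L' analogously with the primed coefficients. If L' u = e^{−g}·L(e^{g}·u) for every smooth u : ℝ³ → ℝ, then the three compatibility invariants agree: ∂_y a011' − ∂_x a101' = ∂_y a011 − ∂_x a101, ∂_z a011' − ∂_x a110' = ∂_z a011 − ∂_x a110, and ∂_z a101' − ∂_y a110' = ∂_z a101 − ∂_y a110. -/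
noncomputable def dx (f : (Fin 3 → ℝ) → ℝ) : (Fin 3 → ℝ) → ℝ :=
  fun p => fderiv ℝ f p (Pi.single 0 1)

noncomputable def dy (f : (Fin 3 → ℝ) → ℝ) : (Fin 3 → ℝ) → ℝ :=
  fun p => fderiv ℝ f p (Pi.single 1 1)

noncomputable def dz (f : (Fin 3 → ℝ) → ℝ) : (Fin 3 → ℝ) → ℝ :=
  fun p => fderiv ℝ f p (Pi.single 2 1)

/-- The derivative of `f` in the constant direction `v`, as a function of the base point. -/
noncomputable def dirDeriv (v : Fin 3 → ℝ) (f : (Fin 3 → ℝ) → ℝ) : (Fin 3 → ℝ) → ℝ :=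
  fun p => fderiv ℝ f p v

theorem dx_eq_dirDeriv : dx = dirDeriv (Pi.single 0 1) := rfl

theorem dy_eq_dirDeriv : dy = dirDeriv (Pi.single 1 1) := rfl

theorem dz_eq_dirDeriv : dz = dirDeriv (Pi.single 2 1) := rfl

theorem ContDiff.dirDeriv {f : (Fin 3 → ℝ) → ℝ} (hf : ContDiff ℝ (⊤ : ℕ∞) f) (v : Fin 3 → ℝ) :
    ContDiff ℝ (⊤ : ℕ∞) (dirDeriv v f) :=
  (hf.fderiv_right (m := (⊤ : ℕ∞)) (by simp)).clm_apply contDiff_const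

theorem ContDiff.differentiableAt_of_smooth {f : (Fin 3 → ℝ) → ℝ}
    (hf : ContDiff ℝ (⊤ : ℕ∞) f) (x : Fin 3 → ℝ) : DifferentiableAt ℝ f x :=
  (hf.differentiable (by simp)) x

theorem dirDeriv_add {f h : (Fin 3 → ℝ) → ℝ} (hf : ContDiff ℝ (⊤ : ℕ∞) f)
    (hh : ContDiff ℝ (⊤ : ℕ∞) h) (v : Fin 3 → ℝ) :
    dirDeriv v (fun y => f y + h y) = fun y => dirDeriv v f y + dirDeriv v h y := by
  funext x
  simp only [dirDeriv]
  rw [fderiv_fun_add (hf.differentiableAt_of_smooth x) (hh.differentiableAt_of_smooth x)]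
  rfl

theorem dirDeriv_mul {f h : (Fin 3 → ℝ) → ℝ} (hf : ContDiff ℝ (⊤ : ℕ∞) f)
    (hh : ContDiff ℝ (⊤ : ℕ∞) h) (v : Fin 3 → ℝ) :
    dirDeriv v (fun y => f y * h y) = fun y => f y * dirDeriv v h y + dirDeriv v f y * h y := by
  funext x
  simp only [dirDeriv]
  rw [fderiv_fun_mul (hf.differentiableAt_of_smooth x) (hh.differentiableAt_of_smooth x)]
  simp [mul_comm]

theorem dirDeriv_exp {g : (Fin 3 → ℝ) → ℝ} (hg : ContDiff ℝ (⊤ : ℕ∞) g) (v : Fin 3 → ℝ) :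
    dirDeriv v (fun y => Real.exp (g y)) = fun y => Real.exp (g y) * dirDeriv v g y := by
  funext x
  simp only [dirDeriv]
  rw [fderiv_exp (hg.differentiableAt_of_smooth x)]
  simp

theorem dirDeriv_comm {f : (Fin 3 → ℝ) → ℝ} (hf : ContDiff ℝ (⊤ : ℕ∞) f) (v w : Fin 3 → ℝ) :
    dirDeriv v (dirDeriv w f) = dirDeriv w (dirDeriv v f) := by
  funext x
  have hd : DifferentiableAt ℝ (fderiv ℝ f) x :=
    ((hf.fderiv_right (m := (⊤ : ℕ∞)) (by simp)).differentiable (by simp)) x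
  have hs : IsSymmSndFDerivAt ℝ f x :=
    hf.contDiffAt.isSymmSndFDerivAt (by
      rw [minSmoothness_of_isRCLikeNormedField]
      exact WithTop.coe_le_coe.2 (le_top : (2 : ℕ∞) ≤ ⊤))
  have key : ∀ a b : Fin 3 → ℝ,
      dirDeriv a (dirDeriv b f) x = fderiv ℝ (fderiv ℝ f) x a b := by
    intro a b
    unfold dirDeriv
    rw [fderiv_clm_apply hd (differentiableAt_const b)]
    simp
  rw [key, key]
  exact hs v w

theorem dirDeriv_dirDeriv_mul {f h : (Fin 3 → ℝ) → ℝ} (hf : ContDiff ℝ (⊤ : ℕ∞) f)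
    (hh : ContDiff ℝ (⊤ : ℕ∞) h) (v w : Fin 3 → ℝ) :
    dirDeriv v (dirDeriv w (fun y => f y * h y)) = fun y =>
      (f y * dirDeriv v (dirDeriv w h) y + dirDeriv v f y * dirDeriv w h y)
        + (dirDeriv w f y * dirDeriv v h y + dirDeriv v (dirDeriv w f) y * h y) := by
  rw [dirDeriv_mul hf hh, dirDeriv_add (hf.mul (hh.dirDeriv w)) ((hf.dirDeriv w).mul hh),
    dirDeriv_mul hf (hh.dirDeriv w), dirDeriv_mul (hf.dirDeriv w) hh]

/-- Third-order Leibniz rule at a point where the second factor vanishes to first order. -/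
theorem dirDeriv_dirDeriv_dirDeriv_mul {f h : (Fin 3 → ℝ) → ℝ} (hf : ContDiff ℝ (⊤ : ℕ∞) f)
    (hh : ContDiff ℝ (⊤ : ℕ∞) h) {x : Fin 3 → ℝ} (h0 : h x = 0) (h1 : ∀ v, dirDeriv v h x = 0)
    (u v w : Fin 3 → ℝ) :
    dirDeriv u (dirDeriv v (dirDeriv w (fun y => f y * h y))) x =
      f x * dirDeriv u (dirDeriv v (dirDeriv w h)) x
        + dirDeriv u f x * dirDeriv v (dirDeriv w h) x
        + dirDeriv v f x * dirDeriv u (dirDeriv w h) x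
        + dirDeriv w f x * dirDeriv u (dirDeriv v h) x := by
  have hw := hh.dirDeriv w
  have fw := hf.dirDeriv w
  rw [dirDeriv_mul hf hh, dirDeriv_add (hf.mul hw) (fw.mul hh),
    dirDeriv_add ((hf.mul hw).dirDeriv v) ((fw.mul hh).dirDeriv v),
    dirDeriv_dirDeriv_mul hf hw, dirDeriv_dirDeriv_mul fw hh]
  simp only [h0, h1]
  ring

theorem contDiff_coord_sub_mul (c : Fin 3 → ℝ) (i j : Fin 3) :
    ContDiff ℝ (⊤ : ℕ∞) (fun y : Fin 3 → ℝ => (y i - c i) * (y j - c j)) := by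
  fun_prop

theorem dirDeriv_const (a : ℝ) (v : Fin 3 → ℝ) : dirDeriv v (fun _ => a) = fun _ => 0 := by
  funext x
  simp [dirDeriv]

theorem dirDeriv_coord_sub (a : ℝ) (i : Fin 3) (v : Fin 3 → ℝ) :
    dirDeriv v (fun y => y i - a) = fun _ => v i := by
  funext x
  simp only [dirDeriv]
  rw [fderiv_sub_const, fderiv_apply (by fun_prop)]
  simp

theorem dirDeriv_coord_sub_mul (c : Fin 3 → ℝ) (i j : Fin 3) (v : Fin 3 → ℝ) :
    dirDeriv v (fun y => (y i - c i) * (y j - c j)) =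
      fun y => (y i - c i) * v j + v i * (y j - c j) := by
  rw [dirDeriv_mul (by fun_prop) (by fun_prop), dirDeriv_coord_sub, dirDeriv_coord_sub]

theorem dirDeriv_dirDeriv_coord_sub_mul (c : Fin 3 → ℝ) (i j : Fin 3) (v w : Fin 3 → ℝ) :
    dirDeriv w (dirDeriv v (fun y => (y i - c i) * (y j - c j))) =
      fun _ => w i * v j + v i * w j := by
  rw [dirDeriv_coord_sub_mul, dirDeriv_add (by fun_prop) (by fun_prop),
    dirDeriv_mul (by fun_prop) (by fun_prop), dirDeriv_mul (by fun_prop) (by fun_prop)]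
  simp [dirDeriv_coord_sub, dirDeriv_const]

/-- Coefficient identity obtained by testing the gauge relation on a product of two centred
coordinates, which kills every term except those of order two. -/
theorem gauge_second_order_coeff
    {a110 a101 a011 a100 a010 a001 a000
      a110' a101' a011' a100' a010' a001' a000' g : (Fin 3 → ℝ) → ℝ}
    (hg : ContDiff ℝ (⊤ : ℕ∞) g)
    (hgauge : ∀ u : (Fin 3 → ℝ) → ℝ, ContDiff ℝ (⊤ : ℕ∞) u → ∀ x,
      dx (dy (dz u)) x + a110' x * dx (dy u) x + a101' x * dx (dz u) x
        + a011' x * dy (dz u) x + a100' x * dx u x + a010' x * dy u x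
        + a001' x * dz u x + a000' x * u x =
      Real.exp (-(g x)) *
        (dx (dy (dz (fun y => Real.exp (g y) * u y))) x
          + a110 x * dx (dy (fun y => Real.exp (g y) * u y)) x
          + a101 x * dx (dz (fun y => Real.exp (g y) * u y)) x
          + a011 x * dy (dz (fun y => Real.exp (g y) * u y)) x
          + a100 x * dx (fun y => Real.exp (g y) * u y) x
          + a010 x * dy (fun y => Real.exp (g y) * u y) x
          + a001 x * dz (fun y => Real.exp (g y) * u y) x
          + a000 x * (Real.exp (g x) * u x)))
    (i j : Fin 3) (x : Fin 3 → ℝ) :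
    let q := fun k l : Fin 3 => (Pi.single k 1 : Fin 3 → ℝ) i * (Pi.single l 1 : Fin 3 → ℝ) j
      + (Pi.single l 1 : Fin 3 → ℝ) i * (Pi.single k 1 : Fin 3 → ℝ) j
    a110' x * q 0 1 + a101' x * q 0 2 + a011' x * q 1 2 =
      (a110 x + dz g x) * q 0 1 + (a101 x + dy g x) * q 0 2 + (a011 x + dx g x) * q 1 2 := by
  intro q
  have h := hgauge _ (contDiff_coord_sub_mul x i j) x
  have he : ContDiff ℝ (⊤ : ℕ∞) fun y => Real.exp (g y) := hg.exp
  have hq := contDiff_coord_sub_mul x i j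
  simp only [dx_eq_dirDeriv, dy_eq_dirDeriv, dz_eq_dirDeriv] at h ⊢
  rw [dirDeriv_dirDeriv_dirDeriv_mul he hq (by simp) (by simp [dirDeriv_coord_sub_mul])] at h
  simp only [dirDeriv_dirDeriv_mul he hq, dirDeriv_dirDeriv_coord_sub_mul, dirDeriv_const] at h
  simp only [dirDeriv_mul he hq, dirDeriv_exp hg, dirDeriv_coord_sub_mul, sub_self, mul_zero,
    zero_mul, add_zero, zero_add] at h
  have hexp : Real.exp (-(g x)) * Real.exp (g x) = 1 := by
    rw [← Real.exp_add]; simp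
  linear_combination h +
    ((a110 x + dirDeriv (Pi.single 2 1) g x) * q 0 1
      + (a101 x + dirDeriv (Pi.single 1 1) g x) * q 0 2
      + (a011 x + dirDeriv (Pi.single 0 1) g x) * q 1 2) * hexp

theorem compatibility_invariants_xyz
    (a110 a101 a011 a100 a010 a001 a000
     a110' a101' a011' a100' a010' a001' a000' g : (Fin 3 → ℝ) → ℝ)
    (h110 : ContDiff ℝ (⊤ : ℕ∞) a110) (h101 : ContDiff ℝ (⊤ : ℕ∞) a101) (h011 : ContDiff ℝ (⊤ : ℕ∞) a011)
    (h100 : ContDiff ℝ (⊤ : ℕ∞) a100) (h010 : ContDiff ℝ (⊤ : ℕ∞) a010) (h001 : ContDiff ℝ (⊤ : ℕ∞) a001)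
    (h000 : ContDiff ℝ (⊤ : ℕ∞) a000)
    (h110' : ContDiff ℝ (⊤ : ℕ∞) a110') (h101' : ContDiff ℝ (⊤ : ℕ∞) a101') (h011' : ContDiff ℝ (⊤ : ℕ∞) a011')
    (h100' : ContDiff ℝ (⊤ : ℕ∞) a100') (h010' : ContDiff ℝ (⊤ : ℕ∞) a010') (h001' : ContDiff ℝ (⊤ : ℕ∞) a001')
    (h000' : ContDiff ℝ (⊤ : ℕ∞) a000')
    (hg : ContDiff ℝ (⊤ : ℕ∞) g)
    (hgauge : ∀ u : (Fin 3 → ℝ) → ℝ, ContDiff ℝ (⊤ : ℕ∞) u → ∀ x,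
      dx (dy (dz u)) x + a110' x * dx (dy u) x + a101' x * dx (dz u) x
        + a011' x * dy (dz u) x + a100' x * dx u x + a010' x * dy u x
        + a001' x * dz u x + a000' x * u x =
      Real.exp (-(g x)) *
        (dx (dy (dz (fun y => Real.exp (g y) * u y))) x
          + a110 x * dx (dy (fun y => Real.exp (g y) * u y)) x
          + a101 x * dx (dz (fun y => Real.exp (g y) * u y)) x
          + a011 x * dy (dz (fun y => Real.exp (g y) * u y)) x
          + a100 x * dx (fun y => Real.exp (g y) * u y) x
          + a010 x * dy (fun y => Real.exp (g y) * u y) x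
          + a001 x * dz (fun y => Real.exp (g y) * u y) x
          + a000 x * (Real.exp (g x) * u x))) :
    (∀ x, dy a011' x - dx a101' x = dy a011 x - dx a101 x) ∧
    (∀ x, dz a011' x - dx a110' x = dz a011 x - dx a110 x) ∧
    (∀ x, dz a101' x - dy a110' x = dz a101 x - dy a110 x) := by
  have key := gauge_second_order_coeff hg hgauge
  have e110 : a110' = fun x => a110 x + dz g x := by
    funext x
    simpa using key 0 1 x
  have e101 : a101' = fun x => a101 x + dy g x := by
    funext x
    simpa using key 0 2 x
  have e011 : a011' = fun x => a011 x + dx g x := by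
    funext x
    simpa using key 1 2 x
  subst e110 e101 e011
  simp only [dx_eq_dirDeriv, dy_eq_dirDeriv, dz_eq_dirDeriv, dirDeriv_add h110 (hg.dirDeriv _),
    dirDeriv_add h101 (hg.dirDeriv _), dirDeriv_add h011 (hg.dirDeriv _)]
  refine ⟨fun x => ?_, fun x => ?_, fun x => ?_⟩
  · rw [dirDeriv_comm hg (Pi.single 1 1) (Pi.single 0 1)]
    ring
  · rw [dirDeriv_comm hg (Pi.single 2 1) (Pi.single 0 1)]
    ring
  · rw [dirDeriv_comm hg (Pi.single 2 1) (Pi.single 1 1)]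
    ring
end

section
/- Let a110, a101, a011, a100, a010, a001, a000 and their primed counterparts and g be smooth real functions on ℝ³, and define L u = ∂_x∂_y∂_z u + a110·∂_x∂_y u + a101·∂_x∂_z u + a011·∂_y∂_z u + a100·∂_x u + a010·∂_y u + a001·∂_z u + a000·u, and L' analogously with the primed coefficients. If L' u = e^{−g}·L(e^{g}·u) for every smooth u : ℝ³ → ℝ, then the three upward invariants agree: a100' − a101'·a110' − ∂_y a110' = a100 − a101·a110 − ∂_y a110, a010' − a011'·a110' − ∂_x a110' = a010 − a011·a110 − ∂_x a110, and a001' − a011'·a101' − ∂_x a101' = a001 − a011·a101 − ∂_x a101. -/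
/-- Conjugation by `exp g` shifts a directional derivative by that of `g`. -/
theorem fderiv_exp_mul_apply {g u : (Fin 3 → ℝ) → ℝ} (w x : Fin 3 → ℝ)
    (hg : ContDiff ℝ (⊤ : ℕ∞) g) (hu : ContDiff ℝ (⊤ : ℕ∞) u) :
    fderiv ℝ (fun y => Real.exp (g y) * u y) x w =
      Real.exp (g x) * (fderiv ℝ u x w + fderiv ℝ g x w * u x) := by
  have hg' := (hg.differentiable (by simp)) x
  have hu' := (hu.differentiable (by simp)) x
  rw [fderiv_fun_mul hg'.exp hu', fderiv_exp hg']
  simp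
  ring

theorem contDiff_fderiv_apply_const {f : (Fin 3 → ℝ) → ℝ} (w : Fin 3 → ℝ)
    (hf : ContDiff ℝ (⊤ : ℕ∞) f) : ContDiff ℝ (⊤ : ℕ∞) (fun p => fderiv ℝ f p w) :=
  (hf.fderiv_right (by simp)).clm_apply contDiff_const

/-- The product of three affine functions, one in each coordinate, centred at `x`. -/
def affineProd (x : Fin 3 → ℝ) (α a β b γ c : ℝ) : (Fin 3 → ℝ) → ℝ :=
  fun p => (α + a * (p 0 - x 0)) * (β + b * (p 1 - x 1)) * (γ + c * (p 2 - x 2))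

@[fun_prop]
theorem contDiff_affineProd (x : Fin 3 → ℝ) (α a β b γ c : ℝ) :
    ContDiff ℝ (⊤ : ℕ∞) (affineProd x α a β b γ c) := by
  unfold affineProd
  fun_prop

theorem affineProd_self (x : Fin 3 → ℝ) (α a β b γ c : ℝ) :
    affineProd x α a β b γ c x = α * β * γ := by
  simp [affineProd]

theorem hasFDerivAt_affine (α a : ℝ) (x p : Fin 3 → ℝ) (i : Fin 3) :
    HasFDerivAt (fun q : Fin 3 → ℝ => α + a * (q i - x i))
      (a • ContinuousLinearMap.proj (R := ℝ) (φ := fun _ : Fin 3 => ℝ) i) p :=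
  (((hasFDerivAt_apply i p).sub_const (x i)).const_mul a).const_add α

theorem fderiv_affineProd_apply (x p w : Fin 3 → ℝ) (α a β b γ c : ℝ) :
    fderiv ℝ (affineProd x α a β b γ c) p w =
      w 0 * affineProd x a 0 β b γ c p + w 1 * affineProd x α a b 0 γ c p
        + w 2 * affineProd x α a β b c 0 p := by
  have h := (((hasFDerivAt_affine α a x p 0).mul (hasFDerivAt_affine β b x p 1)).mul
    (hasFDerivAt_affine γ c x p 2)).fderiv
  have e : fderiv ℝ (affineProd x α a β b γ c) p = _ := h
  rw [e]
  simp [affineProd]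
  ring

theorem dx_affineProd (x : Fin 3 → ℝ) (α a β b γ c : ℝ) :
    dx (affineProd x α a β b γ c) = affineProd x a 0 β b γ c := by
  ext p
  simp [dx, fderiv_affineProd_apply]

theorem dy_affineProd (x : Fin 3 → ℝ) (α a β b γ c : ℝ) :
    dy (affineProd x α a β b γ c) = affineProd x α a b 0 γ c := by
  ext p
  simp [dy, fderiv_affineProd_apply]

theorem dz_affineProd (x : Fin 3 → ℝ) (α a β b γ c : ℝ) :
    dz (affineProd x α a β b γ c) = affineProd x α a β b c 0 := by
  ext p
  simp [dz, fderiv_affineProd_apply]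

@[fun_prop]
theorem ContDiff.dx {f : (Fin 3 → ℝ) → ℝ} (hf : ContDiff ℝ (⊤ : ℕ∞) f) :
    ContDiff ℝ (⊤ : ℕ∞) (dx f) :=
  contDiff_fderiv_apply_const _ hf

theorem dx_exp_mul {g u : (Fin 3 → ℝ) → ℝ} (hg : ContDiff ℝ (⊤ : ℕ∞) g)
    (hu : ContDiff ℝ (⊤ : ℕ∞) u) :
    dx (fun y => Real.exp (g y) * u y) = fun y => Real.exp (g y) * (dx u y + dx g y * u y) :=
  funext fun x => fderiv_exp_mul_apply _ x hg hu

theorem dx_add {u v : (Fin 3 → ℝ) → ℝ} (hu : ContDiff ℝ (⊤ : ℕ∞) u)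
    (hv : ContDiff ℝ (⊤ : ℕ∞) v) :
    dx (fun y => u y + v y) = fun y => dx u y + dx v y := by
  ext x
  simp [dx, fderiv_fun_add (hu.differentiable (by simp) x) (hv.differentiable (by simp) x)]

theorem dx_mul {u v : (Fin 3 → ℝ) → ℝ} (hu : ContDiff ℝ (⊤ : ℕ∞) u)
    (hv : ContDiff ℝ (⊤ : ℕ∞) v) :
    dx (fun y => u y * v y) = fun y => u y * dx v y + v y * dx u y := by
  ext x
  simp [dx, fderiv_fun_mul (hu.differentiable (by simp) x) (hv.differentiable (by simp) x)]

@[fun_prop]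
theorem ContDiff.dy {f : (Fin 3 → ℝ) → ℝ} (hf : ContDiff ℝ (⊤ : ℕ∞) f) :
    ContDiff ℝ (⊤ : ℕ∞) (dy f) :=
  contDiff_fderiv_apply_const _ hf

theorem dy_exp_mul {g u : (Fin 3 → ℝ) → ℝ} (hg : ContDiff ℝ (⊤ : ℕ∞) g)
    (hu : ContDiff ℝ (⊤ : ℕ∞) u) :
    dy (fun y => Real.exp (g y) * u y) = fun y => Real.exp (g y) * (dy u y + dy g y * u y) :=
  funext fun x => fderiv_exp_mul_apply _ x hg hu

theorem dy_add {u v : (Fin 3 → ℝ) → ℝ} (hu : ContDiff ℝ (⊤ : ℕ∞) u)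
    (hv : ContDiff ℝ (⊤ : ℕ∞) v) :
    dy (fun y => u y + v y) = fun y => dy u y + dy v y := by
  ext x
  simp [dy, fderiv_fun_add (hu.differentiable (by simp) x) (hv.differentiable (by simp) x)]

theorem dy_mul {u v : (Fin 3 → ℝ) → ℝ} (hu : ContDiff ℝ (⊤ : ℕ∞) u)
    (hv : ContDiff ℝ (⊤ : ℕ∞) v) :
    dy (fun y => u y * v y) = fun y => u y * dy v y + v y * dy u y := by
  ext x
  simp [dy, fderiv_fun_mul (hu.differentiable (by simp) x) (hv.differentiable (by simp) x)]

@[fun_prop]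
theorem ContDiff.dz {f : (Fin 3 → ℝ) → ℝ} (hf : ContDiff ℝ (⊤ : ℕ∞) f) :
    ContDiff ℝ (⊤ : ℕ∞) (dz f) :=
  contDiff_fderiv_apply_const _ hf

theorem dz_exp_mul {g u : (Fin 3 → ℝ) → ℝ} (hg : ContDiff ℝ (⊤ : ℕ∞) g)
    (hu : ContDiff ℝ (⊤ : ℕ∞) u) :
    dz (fun y => Real.exp (g y) * u y) = fun y => Real.exp (g y) * (dz u y + dz g y * u y) :=
  funext fun x => fderiv_exp_mul_apply _ x hg hu

theorem upward_invariants_xyz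
    (a110 a101 a011 a100 a010 a001 a000
     a110' a101' a011' a100' a010' a001' a000' g : (Fin 3 → ℝ) → ℝ)
    (h110 : ContDiff ℝ (⊤ : ℕ∞) a110) (h101 : ContDiff ℝ (⊤ : ℕ∞) a101) (h011 : ContDiff ℝ (⊤ : ℕ∞) a011)
    (h100 : ContDiff ℝ (⊤ : ℕ∞) a100) (h010 : ContDiff ℝ (⊤ : ℕ∞) a010) (h001 : ContDiff ℝ (⊤ : ℕ∞) a001)
    (h000 : ContDiff ℝ (⊤ : ℕ∞) a000)
    (h110' : ContDiff ℝ (⊤ : ℕ∞) a110') (h101' : ContDiff ℝ (⊤ : ℕ∞) a101') (h011' : ContDiff ℝ (⊤ : ℕ∞) a011')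
    (h100' : ContDiff ℝ (⊤ : ℕ∞) a100') (h010' : ContDiff ℝ (⊤ : ℕ∞) a010') (h001' : ContDiff ℝ (⊤ : ℕ∞) a001')
    (h000' : ContDiff ℝ (⊤ : ℕ∞) a000')
    (hg : ContDiff ℝ (⊤ : ℕ∞) g)
    (hgauge : ∀ u : (Fin 3 → ℝ) → ℝ, ContDiff ℝ (⊤ : ℕ∞) u → ∀ x,
      dx (dy (dz u)) x + a110' x * dx (dy u) x + a101' x * dx (dz u) x
        + a011' x * dy (dz u) x + a100' x * dx u x + a010' x * dy u x
        + a001' x * dz u x + a000' x * u x =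
      Real.exp (-(g x)) *
        (dx (dy (dz (fun y => Real.exp (g y) * u y))) x
          + a110 x * dx (dy (fun y => Real.exp (g y) * u y)) x
          + a101 x * dx (dz (fun y => Real.exp (g y) * u y)) x
          + a011 x * dy (dz (fun y => Real.exp (g y) * u y)) x
          + a100 x * dx (fun y => Real.exp (g y) * u y) x
          + a010 x * dy (fun y => Real.exp (g y) * u y) x
          + a001 x * dz (fun y => Real.exp (g y) * u y) x
          + a000 x * (Real.exp (g x) * u x))) :
    (∀ x, a100' x - a101' x * a110' x - dy a110' x =
          a100 x - a101 x * a110 x - dy a110 x) ∧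
    (∀ x, a010' x - a011' x * a110' x - dx a110' x =
          a010 x - a011 x * a110 x - dx a110 x) ∧
    (∀ x, a001' x - a011' x * a101' x - dx a101' x =
          a001 x - a011 x * a101 x - dx a101 x) := by
  have key : ∀ x α a β b γ c,
      a * b * c + a110' x * (a * b * γ) + a101' x * (a * β * c) + a011' x * (α * b * c)
        + a100' x * (a * β * γ) + a010' x * (α * b * γ) + a001' x * (α * β * c)
        + a000' x * (α * β * γ) =
      a * b * c + (a110 x + dz g x) * (a * b * γ) + (a101 x + dy g x) * (a * β * c)
        + (a011 x + dx g x) * (α * b * c)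
        + (a100 x + a110 x * dy g x + a101 x * dz g x + dy (dz g) x + dy g x * dz g x)
          * (a * β * γ)
        + (a010 x + a110 x * dx g x + a011 x * dz g x + dx (dz g) x + dx g x * dz g x)
          * (α * b * γ)
        + (a001 x + a101 x * dx g x + a011 x * dy g x + dx (dy g) x + dx g x * dy g x)
          * (α * β * c)
        + (a000 x + a100 x * dx g x + a010 x * dy g x + a001 x * dz g x
          + a110 x * (dx (dy g) x + dx g x * dy g x) + a101 x * (dx (dz g) x + dx g x * dz g x)
          + a011 x * (dy (dz g) x + dy g x * dz g x)
          + (dx (dy (dz g)) x + dx g x * dy (dz g) x + dx (dy g) x * dz g x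
            + dy g x * dx (dz g) x + dx g x * dy g x * dz g x)) * (α * β * γ) := by
    intro x α a β b γ c
    have hu := contDiff_affineProd x α a β b γ c
    have h := hgauge _ hu x
    rw [dy_exp_mul hg hu, dz_exp_mul hg hu, dx_exp_mul hg hu,
      dx_exp_mul hg (by fun_prop), dx_exp_mul hg (by fun_prop),
      dy_exp_mul hg (by fun_prop), dx_exp_mul hg (by fun_prop)] at h
    simp (disch := fun_prop) only [dx_add, dy_add, dx_mul, dy_mul, dx_affineProd, dy_affineProd,
      dz_affineProd, affineProd_self] at h
    have hE : Real.exp (-(g x)) * Real.exp (g x) = 1 := by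
      rw [← Real.exp_add, neg_add_cancel, Real.exp_zero]
    refine h.trans (.trans ?_ (one_mul _))
    rw [← hE]
    ring
  have key110 : ∀ x, a110' x = a110 x + dz g x := fun x => by
    linarith [key x 0 1 0 1 1 0]
  have key101 : ∀ x, a101' x = a101 x + dy g x := fun x => by
    linarith [key x 0 1 1 0 0 1]
  have key011 : ∀ x, a011' x = a011 x + dx g x := fun x => by
    linarith [key x 1 0 0 1 0 1]
  have hdx110 : ∀ x, dx a110' x = dx a110 x + dx (dz g) x := fun x => by
    rw [funext key110, dx_add h110 hg.dz]
  have hdy110 : ∀ x, dy a110' x = dy a110 x + dy (dz g) x := fun x => by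
    rw [funext key110, dy_add h110 hg.dz]
  have hdx101 : ∀ x, dx a101' x = dx a101 x + dx (dy g) x := fun x => by
    rw [funext key101, dx_add h101 hg.dy]
  refine ⟨fun x => ?_, fun x => ?_, fun x => ?_⟩
  · rw [hdy110, key101, key110]
    linear_combination key x 0 1 1 0 1 0
  · rw [hdx110, key011, key110]
    linear_combination key x 1 0 0 1 1 0
  · rw [hdx101, key011, key101]
    linear_combination key x 1 0 1 0 0 1
end

section
/- Let p, q, g and a220, a130, a112, a103, a013 and a220', a130', a112', a103', a013' be smooth real functions on ℝ³, and suppose they satisfy the gauge transformation laws of the class maximally generated by {p·∂_x²∂_y²∂_z, q·∂_x∂_y³∂_z, ∂_x∂_y∂_z³}: a220' = a220 + p·∂_z g, a130' = a130 + q·∂_z g, a112' = a112 + 3·∂_z g, a103' = a103 + ∂_y g, a013' = a013 + ∂_x g. Then: (i) if p(x) ≠ 0 for all x ∈ ℝ³, then a220'/p − a112'/3 = a220/p − a112/3; (ii) if q(x) ≠ 0 for all x ∈ ℝ³, then a130'/q − a112'/3 = a130/q − a112/3; and (iii) ∂_x a103' − ∂_y a013' = ∂_x a103 − ∂_y a013.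 -/
theorem fderiv_fderiv_apply_comm {E F : Type*} [NormedAddCommGroup E] [NormedSpace ℝ E]
    [NormedAddCommGroup F] [NormedSpace ℝ F] {f : E → F} {x : E} (hf : ContDiffAt ℝ 2 f x)
    (u v : E) :
    fderiv ℝ (fun y => fderiv ℝ f y v) x u = fderiv ℝ (fun y => fderiv ℝ f y u) x v := by
  have hd : DifferentiableAt ℝ (fderiv ℝ f) x :=
    (hf.fderiv_right (m := 1) (by norm_num)).differentiableAt (by norm_num)
  have hs : IsSymmSndFDerivAt ℝ f x := hf.isSymmSndFDerivAt (by simp)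
  rw [fderiv_clm_apply hd (differentiableAt_const v),
    fderiv_clm_apply hd (differentiableAt_const u)]
  simpa using hs.eq u v

theorem differentiable_fderiv_apply {E F : Type*} [NormedAddCommGroup E] [NormedSpace ℝ E]
    [NormedAddCommGroup F] [NormedSpace ℝ F] {f : E → F} (hf : ContDiff ℝ 2 f) (v : E) :
    Differentiable ℝ (fun y => fderiv ℝ f y v) :=
  ((hf.fderiv_right (m := 1) (by norm_num)).differentiable (by norm_num)).clm_apply
    (differentiable_const v)

theorem extra_and_compatibility_invariants_example
    (p q g a220 a130 a112 a103 a013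
     a220' a130' a112' a103' a013' : (Fin 3 → ℝ) → ℝ)
    (hp : ContDiff ℝ (⊤ : ℕ∞) p) (hq : ContDiff ℝ (⊤ : ℕ∞) q) (hg : ContDiff ℝ (⊤ : ℕ∞) g)
    (h220 : ContDiff ℝ (⊤ : ℕ∞) a220) (h130 : ContDiff ℝ (⊤ : ℕ∞) a130) (h112 : ContDiff ℝ (⊤ : ℕ∞) a112)
    (h103 : ContDiff ℝ (⊤ : ℕ∞) a103) (h013 : ContDiff ℝ (⊤ : ℕ∞) a013)
    (h220' : ContDiff ℝ (⊤ : ℕ∞) a220') (h130' : ContDiff ℝ (⊤ : ℕ∞) a130') (h112' : ContDiff ℝ (⊤ : ℕ∞) a112')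
    (h103' : ContDiff ℝ (⊤ : ℕ∞) a103') (h013' : ContDiff ℝ (⊤ : ℕ∞) a013')
    (hl220 : ∀ x, a220' x = a220 x + p x * dz g x)
    (hl130 : ∀ x, a130' x = a130 x + q x * dz g x)
    (hl112 : ∀ x, a112' x = a112 x + 3 * dz g x)
    (hl103 : ∀ x, a103' x = a103 x + dy g x)
    (hl013 : ∀ x, a013' x = a013 x + dx g x) :
    ((∀ x, p x ≠ 0) →
      ∀ x, a220' x / p x - a112' x / 3 = a220 x / p x - a112 x / 3) ∧
    ((∀ x, q x ≠ 0) →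
      ∀ x, a130' x / q x - a112' x / 3 = a130 x / q x - a112 x / 3) ∧
    (∀ x, dx a103' x - dy a013' x = dx a103 x - dy a013 x) := by
  refine ⟨fun h x => ?_, fun h x => ?_, fun x => ?_⟩
  · have := h x
    rw [hl220, hl112]
    field_simp
    ring
  · have := h x
    rw [hl130, hl112]
    field_simp
    ring
  · have hg2 : ContDiff ℝ 2 g := contDiff_infty.mp hg 2
    have hx : dx a103' x = dx a103 x + dx (dy g) x := by
      have ha : DifferentiableAt ℝ a103 x := h103.differentiable (by simp) x
      have hb : DifferentiableAt ℝ (dy g) x := differentiable_fderiv_apply hg2 _ x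
      rw [show a103' = a103 + dy g from funext hl103]
      simp only [dx, fderiv_add ha hb, add_apply]
    have hy : dy a013' x = dy a013 x + dy (dx g) x := by
      have ha : DifferentiableAt ℝ a013 x := h013.differentiable (by simp) x
      have hb : DifferentiableAt ℝ (dx g) x := differentiable_fderiv_apply hg2 _ x
      rw [show a013' = a013 + dx g from funext hl013]
      simp only [dy, fderiv_add ha hb, add_apply]
    have hxy : dx (dy g) x = dy (dx g) x := fderiv_fderiv_apply_comm hg2.contDiffAt _ _
    rw [hx, hy, hxy]
    ring
end
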